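/- arXiv:2201.08703 — 4 statements merged into one kernel-verified Lean document; each statement's English description precedes it below -/
import Mathlib

section
/- Every homogeneous polynomial F of degree 2d (with d ≥ 1) in the complex polynomial ring ℂ[x,y,z] can be written in the form F = F₁G₁ + F₂G₂, where F₁, G₁, F₂, G₂ ∈ ℂ[x,y,z] are homogeneous polynomials of degree d. -/
open MvPolynomial

theorem degree_eq_of_coeff_ne_zero {σ R : Type*} [CommSemiring R] {m : ℕ} {a : MvPolynomial σ R}
    (ha : a.IsHomogeneous m) {n : σ →₀ ℕ} (h : coeff n a ≠ 0) : n.degree = m := by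
  by_contra hne
  exact h (ha.coeff_eq_zero hne)

theorem homogeneousComponent_mul_of_isHomogeneous {σ R : Type*} [CommSemiring R] {k m : ℕ}
    (α : MvPolynomial σ R) {a : MvPolynomial σ R} (ha : a.IsHomogeneous m) :
    homogeneousComponent (k + m) (α * a) = homogeneousComponent k α * a := by
  classical
  ext n
  rw [coeff_homogeneousComponent, coeff_mul, coeff_mul]
  split_ifs with h
  · refine Finset.sum_congr rfl fun p hp => ?_
    rw [coeff_homogeneousComponent]
    split_ifs with h1
    · rfl
    · by_cases h2 : coeff p.2 a = 0
      · simp [h2]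
      · exfalso
        have := degree_eq_of_coeff_ne_zero ha h2
        rw [← Finset.HasAntidiagonal.mem_antidiagonal.1 hp, map_add] at h
        omega
  · symm
    refine Finset.sum_eq_zero fun p hp => ?_
    rw [coeff_homogeneousComponent]
    split_ifs with h1
    · by_cases h2 : coeff p.2 a = 0
      · simp [h2]
      · exfalso
        have := degree_eq_of_coeff_ne_zero ha h2
        rw [← Finset.HasAntidiagonal.mem_antidiagonal.1 hp, map_add] at h
        omega
    · simp

theorem homogeneousComponent_mul_of_totalDegree_le {σ R : Type*} [CommSemiring R] {a b : ℕ}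
    {A B : MvPolynomial σ R} (hA : A.totalDegree ≤ a) (hB : B.totalDegree ≤ b) :
    homogeneousComponent (a + b) (A * B) =
      homogeneousComponent a A * homogeneousComponent b B := by
  classical
  ext n
  rw [coeff_homogeneousComponent, coeff_mul, coeff_mul]
  split_ifs with h
  · refine Finset.sum_congr rfl fun p hp => ?_
    rw [coeff_homogeneousComponent, coeff_homogeneousComponent]
    rw [← Finset.HasAntidiagonal.mem_antidiagonal.1 hp, map_add] at h
    by_cases h1 : p.1.degree = a
    · rw [if_pos h1, if_pos (by omega)]
    · rw [if_neg h1, zero_mul]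
      by_cases h2 : coeff p.1 A = 0
      · simp [h2]
      · have h3 : p.1.degree ≤ a := (le_totalDegree (mem_support_iff.2 h2)).trans hA
        have h4 : coeff p.2 B = 0 := by
          by_contra h4
          have : p.2.degree ≤ b := (le_totalDegree (mem_support_iff.2 h4)).trans hB
          omega
        simp [h4]
  · symm
    refine Finset.sum_eq_zero fun p hp => ?_
    rw [coeff_homogeneousComponent, coeff_homogeneousComponent]
    rw [← Finset.HasAntidiagonal.mem_antidiagonal.1 hp, map_add] at h
    split_ifs
    · omega
    all_goals simp

theorem eval_smul_of_isHomogeneous {σ R : Type*} [Fintype σ] [CommSemiring R] {n : ℕ}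
    {F : MvPolynomial σ R} (hF : F.IsHomogeneous n) (c : R) (v : σ → R) : eval (c • v) F = c ^ n * eval v F := by
  rw [eval_eq', eval_eq', Finset.mul_sum]
  refine Finset.sum_congr rfl fun m hm => ?_
  have := hF.degree_eq_sum_deg_support hm
  simp only [Pi.smul_apply, smul_eq_mul, mul_pow, Finset.prod_mul_distrib,
    Finset.prod_pow_eq_pow_sum]
  have h2 : ∑ i, m i = n := by
    rw [this]; symm
    apply Finset.sum_subset (Finset.subset_univ _)
    simp
  rw [h2]; ring

theorem eval_aeval {σ τ : Type*} (g : σ → MvPolynomial τ ℂ) (v : τ → ℂ) (F : MvPolynomial σ ℂ) :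
    eval v (aeval g F) = eval (fun i => eval v (g i)) F := by
  have : (aeval v : _ →ₐ[ℂ] ℂ).comp (aeval g) = aeval fun i => eval v (g i) := by
    ext i
    simp [aeval_eq_eval]
  simpa [aeval_eq_eval] using DFunLike.congr_fun this F

/-- Restriction of a ternary form to the affine line `(ρ : 1 : T)`. -/
noncomputable def restrictLine (ρ : ℂ) : MvPolynomial (Fin 3) ℂ →ₐ[ℂ] Polynomial ℂ :=
  aeval ![Polynomial.C ρ, 1, Polynomial.X]

@[simp] theorem restrictLine_X_zero (ρ : ℂ) : restrictLine ρ (X 0) = Polynomial.C ρ := by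
  simp [restrictLine]

@[simp] theorem restrictLine_X_one (ρ : ℂ) : restrictLine ρ (X 1) = 1 := by
  simp [restrictLine]

@[simp] theorem restrictLine_X_two (ρ : ℂ) : restrictLine ρ (X 2) = Polynomial.X := by
  simp [restrictLine]

@[simp] theorem restrictLine_C (ρ c : ℂ) : restrictLine ρ (C c) = Polynomial.C c := by
  simp [restrictLine]

theorem eval_restrictLine (ρ t : ℂ) (F : MvPolynomial (Fin 3) ℂ) :
    (restrictLine ρ F).eval t = eval ![ρ, 1, t] F := by
  have : ((Polynomial.aeval t).comp (restrictLine ρ)) = aeval ![ρ, 1, t] := by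
    ext i
    fin_cases i <;> simp
  have := DFunLike.congr_fun this F
  simpa [Polynomial.aeval_def, MvPolynomial.aeval_eq_eval] using this

theorem natDegree_restrictLine_le (ρ : ℂ) {n : ℕ} {F : MvPolynomial (Fin 3) ℂ}
    (hF : F.IsHomogeneous n) : (restrictLine ρ F).natDegree ≤ n := by
  rw [F.as_sum, map_sum]
  refine Polynomial.natDegree_sum_le_of_forall_le _ _ fun m hm => ?_
  have h := degree_eq_of_coeff_ne_zero hF (mem_support_iff.1 hm)
  rw [monomial_eq, Finsupp.prod_fintype _ _ (by simp)]
  simp only [Fin.prod_univ_three, map_mul, map_pow, restrictLine_C, restrictLine_X_zero,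
    restrictLine_X_one, restrictLine_X_two, one_pow, mul_one]
  rw [← Polynomial.C_pow, ← mul_assoc, ← Polynomial.C_mul]
  refine (Polynomial.natDegree_C_mul_X_pow_le _ _).trans ?_
  rw [Finsupp.degree_eq_sum, Fin.sum_univ_three] at h
  omega

theorem exists_isHomogeneous_restrictLine_eq (ρ : ℂ) {n : ℕ} {p : Polynomial ℂ}
    (hp : p.natDegree ≤ n) :
    ∃ A : MvPolynomial (Fin 3) ℂ, A.IsHomogeneous n ∧ restrictLine ρ A = p := by
  refine ⟨∑ j ∈ Finset.range (n + 1), C (p.coeff j) * (X 1 ^ (n - j) * X 2 ^ j), ?_, ?_⟩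
  · refine IsHomogeneous.sum _ _ _ fun j hj => ?_
    have := ((isHomogeneous_X_pow (R := ℂ) (1 : Fin 3) (n - j)).mul
      (isHomogeneous_X_pow (2 : Fin 3) j)).C_mul (p.coeff j)
    rwa [Nat.sub_add_cancel (Finset.mem_range_succ_iff.1 hj)] at this
  · simp only [map_sum, map_mul, map_pow, restrictLine_C, restrictLine_X_one, restrictLine_X_two,
      one_pow, one_mul]
    exact (p.as_sum_range_C_mul_X_pow' (by omega)).symm

theorem dvd_of_restrictLine_eq_zero {r : ℂ} {n : ℕ} {G : MvPolynomial (Fin 3) ℂ}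
    (hG : G.IsHomogeneous n) (h : restrictLine r G = 0) : X 0 - C r * X 1 ∣ G := by
  set φ : MvPolynomial (Fin 3) ℂ →ₐ[ℂ] MvPolynomial (Fin 3) ℂ := aeval ![C r * X 1, X 1, X 2]
    with hφ
  have hφG : φ G = 0 := by
    have : X 1 * φ G = 0 := by
      refine MvPolynomial.funext fun v => ?_
      have h1 : eval v (φ G) = eval ![r * v 1, v 1, v 2] G := by
        rw [hφ, eval_aeval]
        congr 2
        ext i
        fin_cases i <;> simp
      rw [map_mul, h1, eval_X, map_zero]
      by_cases hv : v 1 = 0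
      · simp [hv]
      have h2 : ![r * v 1, v 1, v 2] = v 1 • ![r, 1, v 2 / v 1] := by
        ext i
        fin_cases i
        · simp [mul_comm]
        · simp
        · simp; field_simp
      rw [h2, eval_smul_of_isHomogeneous hG, ← eval_restrictLine, h]
      simp
    exact (mul_eq_zero.1 this).resolve_left (X_ne_zero _)
  have key : (Ideal.Quotient.mkₐ ℂ (Ideal.span {X 0 - C r * X 1})).comp φ =
      Ideal.Quotient.mkₐ ℂ (Ideal.span {(X 0 - C r * X 1 : MvPolynomial (Fin 3) ℂ)}) := by
    ext i
    fin_cases i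
    · simp only [hφ, AlgHom.comp_apply, Ideal.Quotient.mkₐ_eq_mk]
      symm
      simp only [Fin.zero_eta, aeval_X, Matrix.cons_val_zero, Ideal.Quotient.eq]
      exact Ideal.mem_span_singleton_self _
    · simp [hφ]
    · simp [hφ]
  have := DFunLike.congr_fun key G
  simp only [AlgHom.comp_apply, hφG, map_zero, Ideal.Quotient.mkₐ_eq_mk] at this
  rw [eq_comm, Ideal.Quotient.eq_zero_iff_mem, Ideal.mem_span_singleton] at this
  exact this

theorem exists_eq_add_add_mul_linear {r : ℂ} {k m e : ℕ} (hm : m ≤ k + 1) (he : e + 1 = k + m)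
    {a b F : MvPolynomial (Fin 3) ℂ} (ha : a.IsHomogeneous m) (hb : b.IsHomogeneous m)
    (hF : F.IsHomogeneous (k + m)) (hab : IsCoprime (restrictLine r a) (restrictLine r b))
    (hmonic : (restrictLine r b).Monic) (hdeg : (restrictLine r b).natDegree = m) :
    ∃ α β Q : MvPolynomial (Fin 3) ℂ, α.IsHomogeneous k ∧ β.IsHomogeneous k ∧
      Q.IsHomogeneous e ∧ F = α * a + β * b + Q * (X 0 - C r * X 1) := by
  obtain ⟨s, t, hst⟩ := hab
  set A := restrictLine r a with hA
  set B := restrictLine r b with hB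
  set h := restrictLine r F with hh
  set p := (h * s) %ₘ B with hp
  obtain ⟨q, hq⟩ : ∃ q, h = p * A + q * B := by
    refine ⟨h * t + (h * s) /ₘ B * A, ?_⟩
    have := Polynomial.modByMonic_add_div (h * s) B
    rw [← hp] at this
    linear_combination (-h) * hst + A * (-this)
  have hpk : p.natDegree ≤ k := by
    by_cases hp0 : p = 0
    · simp [hp0]
    have h1 := Polynomial.degree_modByMonic_lt (h * s) hmonic
    rw [← hp] at h1
    have := Polynomial.natDegree_lt_natDegree hp0 h1
    omega
  have hqk : q.natDegree ≤ k := by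
    have h1 : (q * B).natDegree ≤ k + m := by
      have : q * B = h - p * A := by rw [hq]; ring
      rw [this]
      refine (Polynomial.natDegree_sub_le _ _).trans (max_le (natDegree_restrictLine_le r hF) ?_)
      exact Polynomial.natDegree_mul_le.trans
        (Nat.add_le_add hpk (natDegree_restrictLine_le r ha))
    by_cases hq0 : q = 0
    · simp [hq0]
    rw [Polynomial.natDegree_mul hq0 hmonic.ne_zero] at h1
    omega
  obtain ⟨α, hα, hαp⟩ := exists_isHomogeneous_restrictLine_eq r hpk
  obtain ⟨β, hβ, hβq⟩ := exists_isHomogeneous_restrictLine_eq r hqk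
  have hG : (F - α * a - β * b).IsHomogeneous (e + 1) := by
    rw [he]
    exact (hF.sub (hα.mul ha)).sub (hβ.mul hb)
  obtain ⟨Q, hQ⟩ := dvd_of_restrictLine_eq_zero (r := r) hG (by
    simp only [map_sub, map_mul, hαp, hβq, ← hA, ← hB, ← hh]
    rw [hq]; ring)
  have hlin : (X 0 - C r * X 1 : MvPolynomial (Fin 3) ℂ).IsHomogeneous 1 :=
    (isHomogeneous_X _ _).sub (isHomogeneous_C_mul_X _ _)
  refine ⟨α, β, homogeneousComponent e Q, hα, hβ, homogeneousComponent_isHomogeneous _ _, ?_⟩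
  rw [← homogeneousComponent_mul_of_isHomogeneous Q hlin, mul_comm Q, ← hQ,
    homogeneousComponent_eq_self hG]
  ring

/-- A matrix `(u₁ u₂; v₁ v₂)` of ternary forms, with rows of degrees `m` and `n` and determinant
`D`, whose entries generate all forms of degree `m + n`. -/
structure IsGeneratingMatrix (m n : ℕ) (D u₁ u₂ v₁ v₂ : MvPolynomial (Fin 3) ℂ) : Prop where
  hu₁ : u₁.IsHomogeneous m
  hu₂ : u₂.IsHomogeneous m
  hv₁ : v₁.IsHomogeneous n
  hv₂ : v₂.IsHomogeneous n
  det_eq : u₁ * v₂ - u₂ * v₁ = D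
  monic : ∀ ρ, (restrictLine ρ u₂).Monic
  natDegree_eq : ∀ ρ, (restrictLine ρ u₂).natDegree = m
  generates : ∀ F : MvPolynomial (Fin 3) ℂ, F.IsHomogeneous (m + n) →
    ∃ a₁ a₂ b₁ b₂ : MvPolynomial (Fin 3) ℂ, a₁.IsHomogeneous n ∧ a₂.IsHomogeneous n ∧
      b₁.IsHomogeneous m ∧ b₂.IsHomogeneous m ∧ F = a₁ * u₁ + a₂ * u₂ + b₁ * v₁ + b₂ * v₂

theorem IsGeneratingMatrix.step {m n : ℕ} {D u₁ u₂ v₁ v₂ : MvPolynomial (Fin 3) ℂ}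
    (h : IsGeneratingMatrix m n D u₁ u₂ v₁ v₂) (hmn : m ≤ n + 1) {r : ℂ}
    (hr : IsUnit (restrictLine r D)) :
    IsGeneratingMatrix (n + 1) m ((X 0 - C r * X 1) * D)
      (X 2 ^ (n + 1 - m) * u₁ - (X 0 - C r * X 1) * v₁)
      (X 2 ^ (n + 1 - m) * u₂ - (X 0 - C r * X 1) * v₂) u₁ u₂ := by
  have hlin : (X 0 - C r * X 1 : MvPolynomial (Fin 3) ℂ).IsHomogeneous 1 :=
    (isHomogeneous_X _ _).sub (isHomogeneous_C_mul_X _ _)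
  have hhom : ∀ {u v : MvPolynomial (Fin 3) ℂ}, u.IsHomogeneous m → v.IsHomogeneous n →
      (X 2 ^ (n + 1 - m) * u - (X 0 - C r * X 1) * v).IsHomogeneous (n + 1) := by
    intro u v hu hv
    have h1 := (isHomogeneous_X_pow (R := ℂ) (2 : Fin 3) (n + 1 - m)).mul hu
    rw [Nat.sub_add_cancel hmn] at h1
    have h2 := hlin.mul hv
    rw [add_comm] at h2
    exact h1.sub h2
  have hlead : ∀ ρ, (Polynomial.X ^ (n + 1 - m) * restrictLine ρ u₂).Monic ∧
      (Polynomial.X ^ (n + 1 - m) * restrictLine ρ u₂).natDegree = n + 1 := by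
    intro ρ
    refine ⟨(Polynomial.monic_X_pow _).mul (h.monic ρ), ?_⟩
    rw [(Polynomial.monic_X_pow _).natDegree_mul (h.monic ρ), h.natDegree_eq,
      Polynomial.natDegree_X_pow, Nat.sub_add_cancel hmn]
  have hlow : ∀ ρ, (Polynomial.C (ρ - r) * restrictLine ρ v₂).degree <
      (Polynomial.X ^ (n + 1 - m) * restrictLine ρ u₂).degree := by
    intro ρ
    rw [Polynomial.degree_eq_natDegree (hlead ρ).1.ne_zero, (hlead ρ).2]
    refine (Polynomial.degree_le_of_natDegree_le (n := n) ?_).trans_lt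
      (by exact_mod_cast n.lt_succ_self)
    exact (Polynomial.natDegree_C_mul_le _ _).trans (natDegree_restrictLine_le ρ h.hv₂)
  have hrestrict : ∀ ρ, restrictLine ρ (X 2 ^ (n + 1 - m) * u₂ - (X 0 - C r * X 1) * v₂) =
      Polynomial.X ^ (n + 1 - m) * restrictLine ρ u₂ -
        Polynomial.C (ρ - r) * restrictLine ρ v₂ := by
    intro ρ
    simp
  refine ⟨hhom h.hu₁ h.hv₁, hhom h.hu₂ h.hv₂, h.hu₁, h.hu₂, ?_, fun ρ => ?_, fun ρ => ?_,
    fun F hF => ?_⟩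
  · rw [← h.det_eq]; ring
  · rw [hrestrict]
    exact (hlead ρ).1.sub_of_left (hlow ρ)
  · rw [hrestrict, Polynomial.natDegree_sub_eq_left_of_natDegree_lt, (hlead ρ).2]
    rw [(hlead ρ).2, Nat.lt_succ_iff]
    exact (Polynomial.natDegree_C_mul_le _ _).trans (natDegree_restrictLine_le ρ h.hv₂)
  · have hcop : IsCoprime (restrictLine r u₁) (restrictLine r u₂) := by
      obtain ⟨w, hw⟩ := hr.exists_left_inv
      refine ⟨w * restrictLine r v₂, - (w * restrictLine r v₁), ?_⟩
      rw [← hw, ← h.det_eq]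
      simp only [map_sub, map_mul]
      ring
    obtain ⟨α, β, Q, hα, hβ, hQ, hFeq⟩ := exists_eq_add_add_mul_linear (e := m + n) (r := r)
      (by omega) (by omega) h.hu₁ h.hu₂ hF hcop (h.monic r) (h.natDegree_eq r)
    obtain ⟨a₁, a₂, b₁, b₂, ha₁, ha₂, hb₁, hb₂, hQeq⟩ := h.generates Q hQ
    have hcoef : ∀ {α a b : MvPolynomial (Fin 3) ℂ}, α.IsHomogeneous (n + 1) →
        a.IsHomogeneous n → b.IsHomogeneous m →
        (α + (X 0 - C r * X 1) * a + X 2 ^ (n + 1 - m) * b).IsHomogeneous (n + 1) := by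
      intro α a b hα ha hb
      have h1 := (isHomogeneous_X_pow (R := ℂ) (2 : Fin 3) (n + 1 - m)).mul hb
      rw [Nat.sub_add_cancel hmn] at h1
      have h2 := hlin.mul ha
      rw [add_comm] at h2
      exact (hα.add h2).add h1
    refine ⟨-b₁, -b₂, _, _, hb₁.neg, hb₂.neg, hcoef hα ha₁ hb₁, hcoef hβ ha₂ hb₂, ?_⟩
    rw [hFeq, hQeq]
    ring

theorem exists_isGeneratingMatrix (k : ℕ) : ∀ s : Finset ℂ, s.card = k →
    ∃ u₁ u₂ v₁ v₂ : MvPolynomial (Fin 3) ℂ,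
      IsGeneratingMatrix ((k + 1) / 2) (k / 2) (∏ r ∈ s, (X 0 - C r * X 1)) u₁ u₂ v₁ v₂ := by
  induction k with
  | zero =>
    intro s hs
    rw [Finset.card_eq_zero] at hs
    subst hs
    refine ⟨0, 1, -1, 0, isHomogeneous_zero _ _ _, isHomogeneous_one _ _,
      (isHomogeneous_one _ _).neg, isHomogeneous_zero _ _ _, by simp, by simp, by simp,
      fun F hF => ⟨0, F, 0, 0, isHomogeneous_zero _ _ _, by simpa using hF,
        isHomogeneous_zero _ _ _, isHomogeneous_zero _ _ _, by simp⟩⟩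
  | succ k ih =>
    intro s hs
    obtain ⟨r, s, hrs, rfl, hcard⟩ := Finset.card_eq_succ.1 hs
    obtain ⟨u₁, u₂, v₁, v₂, h⟩ := ih s hcard
    have hunit : IsUnit (restrictLine r (∏ ρ ∈ s, (X 0 - C ρ * X 1))) := by
      have : restrictLine r (∏ ρ ∈ s, (X 0 - C ρ * X 1)) = Polynomial.C (∏ ρ ∈ s, (r - ρ)) := by
        simp [map_prod]
      rw [this, Polynomial.isUnit_C, isUnit_iff_ne_zero, Finset.prod_ne_zero_iff]
      intro ρ hρ h0
      exact hrs (sub_eq_zero.1 h0 ▸ hρ)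
    have := h.step (by omega) hunit
    rw [Finset.prod_insert hrs, show (k + 1 + 1) / 2 = k / 2 + 1 by omega]
    exact ⟨_, _, _, _, this⟩

theorem map_nhds_zero_add_quadratic {s : Type*} [Fintype s] (q : s → s → s → ℂ) :
    Filter.map (fun (h : s → ℂ) m => h m + ∑ i, ∑ j, h i * h j * q i j m) (nhds 0) = nhds 0 := by
  have hd : HasStrictFDerivAt (fun (h : s → ℂ) m => h m + ∑ i, ∑ j, h i * h j * q i j m)
      ((ContinuousLinearEquiv.refl ℂ (s → ℂ) : (s → ℂ) ≃L[ℂ] (s → ℂ)) :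
        (s → ℂ) →L[ℂ] (s → ℂ)) 0 := by
    rw [hasStrictFDerivAt_pi']
    intro m
    have h1 : HasStrictFDerivAt (fun h : s → ℂ => ∑ i, ∑ j, h i * h j * q i j m)
        (∑ i : s, ∑ j : s, (0 : (s → ℂ) →L[ℂ] ℂ)) 0 := by
      refine HasStrictFDerivAt.fun_sum fun i _ => HasStrictFDerivAt.fun_sum fun j _ => ?_
      have := ((hasStrictFDerivAt_apply (𝕜 := ℂ) i (0 : s → ℂ)).mul
        (hasStrictFDerivAt_apply (𝕜 := ℂ) j (0 : s → ℂ))).mul_const (q i j m)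
      convert! this using 1
      ext y
      simp
    have h2 := (hasStrictFDerivAt_apply (𝕜 := ℂ) m (0 : s → ℂ)).add h1
    convert! h2 using 1
    ext y
    simp
  refine hd.map_nhds_eq_of_equiv.trans (congrArg nhds ?_)
  funext m
  simp

/-- A form of degree `2 * d` written as a sum of two products of forms of degree `d`. -/
def IsSumOfTwoProducts (d : ℕ) (F : MvPolynomial (Fin 3) ℂ) : Prop :=
  ∃ F₁ G₁ F₂ G₂ : MvPolynomial (Fin 3) ℂ,
    F₁.IsHomogeneous d ∧ G₁.IsHomogeneous d ∧ F₂.IsHomogeneous d ∧ G₂.IsHomogeneous d ∧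
    F = F₁ * G₁ + F₂ * G₂

theorem IsGeneratingMatrix.exists_isSumOfTwoProducts {d : ℕ}
    {D u₁ u₂ v₁ v₂ : MvPolynomial (Fin 3) ℂ} (h : IsGeneratingMatrix d d D u₁ u₂ v₁ v₂)
    (γ : ℂ → MvPolynomial (Fin 3) ℂ) (hγ : ∀ t, (γ t).IsHomogeneous (2 * d))
    (hcont : ∀ m, Continuous fun t => coeff m (γ t)) (hzero : γ 0 = D) :
    ∃ t, t ≠ 0 ∧ IsSumOfTwoProducts d (γ t) := by
  classical
  let s := {m : Fin 3 →₀ ℕ // m.degree = 2 * d}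
  have hfin : Finite s := (Finsupp.finite_of_degree_le (2 * d)).subset fun m hm => le_of_eq hm
  have : Fintype s := Fintype.ofFinite s
  have hgen : ∀ m : s, ∃ a₁ a₂ b₁ b₂ : MvPolynomial (Fin 3) ℂ, a₁.IsHomogeneous d ∧
      a₂.IsHomogeneous d ∧ b₁.IsHomogeneous d ∧ b₂.IsHomogeneous d ∧
      monomial m.1 1 = a₁ * u₁ + a₂ * u₂ + b₁ * v₁ + b₂ * v₂ := fun m =>
    h.generates _ (by rw [← two_mul]; exact isHomogeneous_monomial _ m.2)
  choose a₁ a₂ b₁ b₂ ha₁ ha₂ hb₁ hb₂ hmon using hgen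
  set Φ : (s → ℂ) → s → ℂ := fun x m => x m + ∑ i, ∑ j, x i * x j *
    coeff m.1 (b₂ i * a₁ j - b₁ i * a₂ j) with hΦ
  have hrange : Set.range Φ ∈ nhds (0 : s → ℂ) := by
    rw [← map_nhds_zero_add_quadratic fun i j m => coeff m.1 (b₂ i * a₁ j - b₁ i * a₂ j)]
    exact Filter.range_mem_map
  have hpath : Continuous fun t => fun m : s => coeff m.1 (γ t) - coeff m.1 D :=
    continuous_pi fun m => (hcont m.1).sub continuous_const
  have hev : ∀ᶠ t in nhdsWithin (0 : ℂ) {0}ᶜ,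
      (fun m : s => coeff m.1 (γ t) - coeff m.1 D) ∈ Set.range Φ := by
    refine nhdsWithin_le_nhds (hpath.continuousAt.preimage_mem_nhds ?_)
    convert hrange
    simp [hzero]
  obtain ⟨t, ⟨x, hx⟩, ht⟩ := (hev.and self_mem_nhdsWithin).exists
  refine ⟨t, ht, u₁ + ∑ i, C (x i) * b₂ i, v₂ + ∑ i, C (x i) * a₁ i,
    ∑ i, C (x i) * b₁ i - u₂, v₁ - ∑ i, C (x i) * a₂ i,
    h.hu₁.add (.sum _ _ _ fun i _ => (hb₂ i).C_mul _),
    h.hv₂.add (.sum _ _ _ fun i _ => (ha₁ i).C_mul _),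
    (IsHomogeneous.sum _ _ _ fun i _ => (hb₁ i).C_mul _).sub h.hu₂,
    h.hv₁.sub (.sum _ _ _ fun i _ => (ha₂ i).C_mul _), ?_⟩
  have hexp : (u₁ + ∑ i, C (x i) * b₂ i) * (v₂ + ∑ i, C (x i) * a₁ i) +
      (∑ i, C (x i) * b₁ i - u₂) * (v₁ - ∑ i, C (x i) * a₂ i) =
      D + ∑ i : s, C (x i) * monomial i.1 1 +
        ∑ i, ∑ j, C (x i * x j) * (b₂ i * a₁ j - b₁ i * a₂ j) := by
    have h1 : ∑ i : s, C (x i) * monomial i.1 (1 : ℂ) =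
        (∑ i, C (x i) * a₁ i) * u₁ + (∑ i, C (x i) * a₂ i) * u₂ +
        (∑ i, C (x i) * b₁ i) * v₁ + (∑ i, C (x i) * b₂ i) * v₂ := by
      simp only [Finset.sum_mul, ← Finset.sum_add_distrib]
      refine Finset.sum_congr rfl fun i _ => ?_
      rw [hmon]; ring
    have h2 : ∑ i, ∑ j, C (x i * x j) * (b₂ i * a₁ j - b₁ i * a₂ j) =
        (∑ i, C (x i) * b₂ i) * (∑ i, C (x i) * a₁ i) -
        (∑ i, C (x i) * b₁ i) * (∑ i, C (x i) * a₂ i) := by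
      simp only [Finset.sum_mul_sum, ← Finset.sum_sub_distrib]
      refine Finset.sum_congr rfl fun i _ => Finset.sum_congr rfl fun j _ => ?_
      rw [C_mul]; ring
    rw [h1, h2, ← h.det_eq]; ring
  have hhom : (D + ∑ i : s, C (x i) * monomial i.1 1 +
      ∑ i, ∑ j, C (x i * x j) * (b₂ i * a₁ j - b₁ i * a₂ j)).IsHomogeneous (2 * d) := by
    refine ((hzero ▸ hγ 0).add (.sum _ _ _ fun i _ => ?_)).add
      (.sum _ _ _ fun i _ => .sum _ _ _ fun j _ => ?_)
    · exact (isHomogeneous_monomial _ i.2).C_mul _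
    · rw [two_mul]
      exact (((hb₂ i).mul (ha₁ j)).sub ((hb₁ i).mul (ha₂ j))).C_mul _
  rw [hexp]
  ext m
  by_cases hm : m.degree = 2 * d
  · have := congrFun hx ⟨m, hm⟩
    simp only [hΦ] at this
    rw [eq_comm, sub_eq_iff_eq_add'] at this
    rw [this, coeff_add, coeff_add, add_assoc]
    congr 2
    · simp only [coeff_sum, coeff_C_mul, coeff_monomial]
      rw [Finset.sum_eq_single (⟨m, hm⟩ : s)]
      · simp
      · intro b _ hb
        rw [if_neg fun hb' => hb (Subtype.ext hb'), mul_zero]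
      · simp
    · simp only [coeff_sum, coeff_C_mul]
  · rw [(hγ t).coeff_eq_zero hm, hhom.coeff_eq_zero hm]

theorem squarefree_of_mulEquiv {M N : Type*} [CommMonoid M] [CommMonoid N] (e : M ≃* N) {a : M}
    (ha : Squarefree a) : Squarefree (e a) := by
  intro x hx
  have h1 : e.symm x * e.symm x ∣ a := by
    have := map_dvd e.symm hx
    rwa [map_mul, e.symm_apply_apply] at this
  have := (ha _ h1).map e
  rwa [e.apply_symm_apply] at this

theorem squarefree_map_fractionRing {R : Type*} [CommRing R] [IsDomain R] [IsIntegrallyClosed R]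
    {P : Polynomial R} (hP : P.Monic) (hsq : Squarefree P) :
    Squarefree (P.map (algebraMap R (FractionRing R))) := by
  intro x hx
  obtain ⟨g, hg⟩ := IsIntegrallyClosed.eq_map_mul_C_of_dvd (FractionRing R) hP
    (dvd_of_mul_left_dvd hx)
  have hx0 : x ≠ 0 := by
    rintro rfl
    rw [zero_mul, zero_dvd_iff] at hx
    exact (hP.map _).ne_zero hx
  have hlead : IsUnit (Polynomial.C x.leadingCoeff) :=
    Polynomial.isUnit_C.2 (isUnit_iff_ne_zero.2 (Polynomial.leadingCoeff_ne_zero.2 hx0))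
  have hgm : g.Monic := by
    rw [Function.Injective.monic_map_iff (IsFractionRing.injective R (FractionRing R))]
    have := congrArg Polynomial.leadingCoeff hg
    rw [Polynomial.leadingCoeff_mul, Polynomial.leadingCoeff_C] at this
    exact (mul_eq_right₀ (Polynomial.leadingCoeff_ne_zero.2 hx0)).1 this
  have hdvd : g * g ∣ P := by
    rw [← hP.dvd_iff_fraction_map_dvd_fraction_map (K := FractionRing R) (hgm.mul hgm),
      Polynomial.map_mul]
    refine (mul_dvd_mul ?_ ?_).trans hx <;> exact ⟨_, hg.symm⟩
  rw [← hg, hgm.eq_one_of_isUnit (hsq g hdvd), Polynomial.map_one, one_mul]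
  exact hlead

theorem exists_mul_add_mul_derivative_eq_C {R : Type*} [CommRing R] [IsDomain R]
    [IsIntegrallyClosed R] [CharZero R] {P : Polynomial R} (hP : P.Monic) (hsq : Squarefree P) :
    ∃ (A B : Polynomial R) (r : R), r ≠ 0 ∧ A * P + B * P.derivative = Polynomial.C r := by
  have hinj := IsFractionRing.injective R (FractionRing R)
  obtain ⟨a, b, hab⟩ := PerfectField.separable_iff_squarefree.2 (squarefree_map_fractionRing hP hsq)
  obtain ⟨s, hs, hsa⟩ := IsLocalization.integerNormalization_spec (nonZeroDivisors R) a
  obtain ⟨t, ht, htb⟩ := IsLocalization.integerNormalization_spec (nonZeroDivisors R) b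
  set A := IsLocalization.integerNormalization (nonZeroDivisors R) a
  set B := IsLocalization.integerNormalization (nonZeroDivisors R) b
  refine ⟨Polynomial.C t * A, Polynomial.C s * B, s * t,
    mul_ne_zero (nonZeroDivisors.ne_zero hs) (nonZeroDivisors.ne_zero ht), ?_⟩
  apply Polynomial.map_injective _ hinj
  rw [algebra_compatible_smul (FractionRing R), Polynomial.smul_eq_C_mul] at hsa htb
  simp only [Polynomial.map_add, Polynomial.map_mul, Polynomial.map_C, hsa, htb, map_mul]
  rw [Polynomial.derivative_map] at hab
  linear_combination (Polynomial.C (algebraMap R (FractionRing R) s) *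
    Polynomial.C (algebraMap R (FractionRing R) t)) * hab

theorem exists_eval_eq_prod {d : ℕ} {F : MvPolynomial (Fin 3) ℂ} (hF : F.IsHomogeneous d)
    (hsq : Squarefree F) (hone : eval ![1, 0, 0] F = 1) :
    ∃ (y z : ℂ) (s : Finset ℂ), y ≠ 0 ∧ s.card = d ∧
      ∀ t, eval ![t, y, z] F = ∏ r ∈ s, (t - r) := by
  set P := finSuccEquiv ℂ 2 F with hP
  have heval : ∀ t y z, eval ![t, y, z] F = (P.map (eval ![y, z])).eval t := fun t y z =>
    eval_eq_eval_mv_eval' ![y, z] t F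
  have hPsq : Squarefree P := squarefree_of_mulEquiv (finSuccEquiv ℂ 2).toMulEquiv hsq
  have hzero : P.map (eval ![0, 0]) = Polynomial.X ^ d := by
    refine Polynomial.funext fun t => ?_
    rw [← heval, show (![t, 0, 0] : Fin 3 → ℂ) = t • ![1, 0, 0] by ext i; fin_cases i <;> simp,
      eval_smul_of_isHomogeneous hF, hone]
    simp
  have hlead : P.coeff d = 1 := by
    have h0 := hF.finSuccEquiv_coeff_isHomogeneous d 0 rfl
    rw [← hP, ← totalDegree_zero_iff_isHomogeneous, totalDegree_eq_zero_iff_eq_C] at h0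
    have := congrArg (Polynomial.coeff · d) hzero
    simp only [Polynomial.coeff_map, Polynomial.coeff_X_pow, if_true] at this
    rw [h0, eval_C] at this
    rw [h0, this, C_1]
  have hmonic : P.Monic := by
    refine Polynomial.monic_of_natDegree_le_of_coeff_eq_one d ?_ hlead
    rw [hP, natDegree_finSuccEquiv]
    exact (degreeOf_le_totalDegree _ _).trans hF.totalDegree_le
  have hdeg : P.natDegree = d := by
    rw [← hmonic.natDegree_map (eval ![0, 0]), hzero, Polynomial.natDegree_X_pow]
  obtain ⟨A, B, r, hr, hAB⟩ := exists_mul_add_mul_derivative_eq_C hmonic hPsq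
  obtain ⟨v, hv⟩ : ∃ v, eval v (r * X 0) ≠ 0 := by
    by_contra! h
    exact mul_ne_zero hr (X_ne_zero _) (MvPolynomial.funext fun v => by rw [h v, map_zero])
  rw [map_mul, eval_X] at hv
  have hv' : ![v 0, v 1] = v := by ext i; fin_cases i <;> rfl
  have hsep : (P.map (eval v)).Separable := by
    have := congrArg (Polynomial.map (eval v)) hAB
    simp only [Polynomial.map_add, Polynomial.map_mul, Polynomial.map_C,
      ← Polynomial.derivative_map] at this
    refine ⟨Polynomial.C (eval v r)⁻¹ * A.map (eval v),
      Polynomial.C (eval v r)⁻¹ * B.map (eval v), ?_⟩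
    rw [mul_assoc, mul_assoc, ← mul_add, this, ← Polynomial.C_mul,
      inv_mul_cancel₀ (left_ne_zero_of_mul hv), Polynomial.C_1]
  have hsplit := IsAlgClosed.splits (P.map (eval v))
  have hnodup := Polynomial.nodup_roots hsep
  refine ⟨v 0, v 1, (P.map (eval v)).roots.toFinset, right_ne_zero_of_mul hv, ?_, fun t => ?_⟩
  · rw [Multiset.toFinset_card_of_nodup hnodup, ← hsplit.natDegree_eq_card_roots,
      hmonic.natDegree_map, hdeg]
  · rw [heval, hv', hsplit.eval_eq_prod_roots_of_monic (hmonic.map _), Finset.prod,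
      Multiset.toFinset_val, hnodup.dedup]

theorem IsSumOfTwoProducts.aeval {d : ℕ} {F : MvPolynomial (Fin 3) ℂ}
    (h : IsSumOfTwoProducts d F) {g : Fin 3 → MvPolynomial (Fin 3) ℂ}
    (hg : ∀ i, (g i).IsHomogeneous 1) : IsSumOfTwoProducts d (aeval g F) := by
  obtain ⟨F₁, G₁, F₂, G₂, hF₁, hG₁, hF₂, hG₂, rfl⟩ := h
  refine ⟨MvPolynomial.aeval g F₁, MvPolynomial.aeval g G₁, MvPolynomial.aeval g F₂,
    MvPolynomial.aeval g G₂, ?_, ?_, ?_, ?_, by simp only [map_add, map_mul]⟩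
  · simpa using hF₁.aeval g hg
  · simpa using hG₁.aeval g hg
  · simpa using hF₂.aeval g hg
  · simpa using hG₂.aeval g hg

theorem IsSumOfTwoProducts.C_mul {d : ℕ} {F : MvPolynomial (Fin 3) ℂ}
    (h : IsSumOfTwoProducts d F) (c : ℂ) : IsSumOfTwoProducts d (C c * F) := by
  obtain ⟨F₁, G₁, F₂, G₂, hF₁, hG₁, hF₂, hG₂, rfl⟩ := h
  exact ⟨C c * F₁, G₁, C c * F₂, G₂, hF₁.C_mul c, hG₁, hF₂.C_mul c, hG₂, by ring⟩

theorem isSumOfTwoProducts_of_aeval {d : ℕ} {F : MvPolynomial (Fin 3) ℂ}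
    {g h : Fin 3 → MvPolynomial (Fin 3) ℂ} (hh : ∀ i, (h i).IsHomogeneous 1)
    (hgh : ∀ i, aeval h (g i) = X i) (hF : IsSumOfTwoProducts d (aeval g F)) :
    IsSumOfTwoProducts d F := by
  have key : (aeval h).comp (aeval g) = AlgHom.id ℂ (MvPolynomial (Fin 3) ℂ) := by
    ext1 i
    rw [AlgHom.comp_apply, aeval_X, hgh, AlgHom.id_apply]
  have := hF.aeval hh
  rwa [← AlgHom.comp_apply, key] at this

theorem aeval_X_X_C_mul_X (t : ℂ) (F : MvPolynomial (Fin 3) ℂ) :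
    aeval ![X 0, X 1, C t * X 2] F = ∑ n ∈ F.support, monomial n (coeff n F * t ^ n 2) := by
  conv_lhs => rw [F.as_sum]
  rw [map_sum]
  refine Finset.sum_congr rfl fun n _ => ?_
  rw [monomial_eq, monomial_eq, Finsupp.prod_fintype _ _ (by simp)]
  simp only [Fin.prod_univ_three, map_mul, map_pow, aeval_X, algHom_C, algebraMap_eq,
    Matrix.cons_val]
  ring

theorem isSumOfTwoProducts_of_eval_eq_prod {d : ℕ} {F : MvPolynomial (Fin 3) ℂ}
    (hF : F.IsHomogeneous (2 * d)) {s : Finset ℂ} (hs : s.card = 2 * d)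
    (h : ∀ t, eval ![t, 1, 0] F = ∏ r ∈ s, (t - r)) : IsSumOfTwoProducts d F := by
  obtain ⟨u₁, u₂, v₁, v₂, hM⟩ := exists_isGeneratingMatrix (2 * d) s hs
  rw [show (2 * d + 1) / 2 = d by omega, show 2 * d / 2 = d by omega] at hM
  have hhom : ∀ t : ℂ, ∀ i,
      ((![X 0, X 1, C t * X 2] : Fin 3 → MvPolynomial (Fin 3) ℂ) i).IsHomogeneous 1 := by
    intro t i
    fin_cases i
    · exact isHomogeneous_X _ _
    · exact isHomogeneous_X _ _
    · exact isHomogeneous_C_mul_X _ _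
  obtain ⟨t, ht, hsum⟩ := hM.exists_isSumOfTwoProducts (fun t => aeval ![X 0, X 1, C t * X 2] F)
    (fun t => by simpa using hF.aeval _ (hhom t))
    (fun m => by
      simp only [aeval_X_X_C_mul_X, coeff_sum, coeff_monomial]
      refine continuous_finsetSum _ fun n _ => ?_
      split_ifs <;> fun_prop)
    (by
      refine mul_left_cancel₀ (X_ne_zero (1 : Fin 3)) (MvPolynomial.funext fun v => ?_)
      rw [map_mul, map_mul, eval_X]
      by_cases hv : v 1 = 0
      · simp [hv]
      congr 1
      have h2 : (fun i => eval v ((![X 0, X 1, C 0 * X 2] : Fin 3 → MvPolynomial (Fin 3) ℂ) i)) =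
          v 1 • ![v 0 / v 1, 1, 0] := by
        ext i
        fin_cases i
        · simp; field_simp
        · simp
        · simp
      rw [eval_aeval, h2, eval_smul_of_isHomogeneous hF, h, ← hs, ← Finset.prod_const,
        ← Finset.prod_mul_distrib, map_prod]
      refine Finset.prod_congr rfl fun r _ => ?_
      simp only [map_sub, map_mul, eval_X, eval_C]
      field_simp)
  refine isSumOfTwoProducts_of_aeval (hhom t⁻¹) (fun i => ?_) hsum
  fin_cases i
  · simp
  · simp
  · simp [← mul_assoc, ← C_mul, ht]

theorem isSumOfTwoProducts_of_squarefree_of_eval_eq_one {d : ℕ} {F : MvPolynomial (Fin 3) ℂ}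
    (hF : F.IsHomogeneous (2 * d)) (hsq : Squarefree F) (hone : eval ![1, 0, 0] F = 1) :
    IsSumOfTwoProducts d F := by
  obtain ⟨y, z, s, hy, hs, h⟩ := exists_eval_eq_prod hF hsq hone
  set g : Fin 3 → MvPolynomial (Fin 3) ℂ := ![X 0, C y * X 1, C z * X 1 + X 2] with hg
  have hghom : ∀ i, (g i).IsHomogeneous 1 := by
    intro i
    fin_cases i
    · exact isHomogeneous_X _ _
    · exact isHomogeneous_C_mul_X _ _
    · exact (isHomogeneous_C_mul_X _ _).add (isHomogeneous_X _ _)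
  have hC : (C y * C y⁻¹ : MvPolynomial (Fin 3) ℂ) = 1 := by
    rw [← C_mul, mul_inv_cancel₀ hy, C_1]
  refine isSumOfTwoProducts_of_aeval (g := g) (h := ![X 0, C y⁻¹ * X 1, X 2 - C (z * y⁻¹) * X 1])
    (fun i => ?_) (fun i => ?_) (isSumOfTwoProducts_of_eval_eq_prod
      (by simpa using hF.aeval g hghom) hs fun t => ?_)
  · fin_cases i
    · exact isHomogeneous_X _ _
    · exact isHomogeneous_C_mul_X _ _
    · exact (isHomogeneous_X _ _).sub (isHomogeneous_C_mul_X _ _)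
  · fin_cases i
    · simp [hg]
    · simp [hg]
      linear_combination X 1 * hC
    · simp [hg]
      ring
  · rw [eval_aeval, ← h]
    congr 2
    ext i
    fin_cases i <;> simp [hg]

theorem isSumOfTwoProducts_of_squarefree {d : ℕ} {F : MvPolynomial (Fin 3) ℂ}
    (hF : F.IsHomogeneous (2 * d)) (hsq : Squarefree F) : IsSumOfTwoProducts d F := by
  obtain ⟨v, hv⟩ : ∃ v, eval v (F * X 0) ≠ 0 := by
    by_contra! h
    exact mul_ne_zero hsq.ne_zero (X_ne_zero (0 : Fin 3))
      (MvPolynomial.funext fun v => by rw [h v, map_zero])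
  rw [map_mul, eval_X] at hv
  have hFv := left_ne_zero_of_mul hv
  have hv0 := right_ne_zero_of_mul hv
  set g : Fin 3 → MvPolynomial (Fin 3) ℂ := ![C (v 0) * X 0, C (v 1) * X 0 + X 1,
    C (v 2) * X 0 + X 2] with hg
  set h : Fin 3 → MvPolynomial (Fin 3) ℂ := ![C (v 0)⁻¹ * X 0, X 1 - C (v 1 * (v 0)⁻¹) * X 0,
    X 2 - C (v 2 * (v 0)⁻¹) * X 0] with hh
  have hghom : ∀ i, (g i).IsHomogeneous 1 := by
    intro i
    fin_cases i
    · exact isHomogeneous_C_mul_X _ _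
    · exact (isHomogeneous_C_mul_X _ _).add (isHomogeneous_X _ _)
    · exact (isHomogeneous_C_mul_X _ _).add (isHomogeneous_X _ _)
  have hhhom : ∀ i, (h i).IsHomogeneous 1 := by
    intro i
    fin_cases i
    · exact isHomogeneous_C_mul_X _ _
    · exact (isHomogeneous_X _ _).sub (isHomogeneous_C_mul_X _ _)
    · exact (isHomogeneous_X _ _).sub (isHomogeneous_C_mul_X _ _)
  have hC : (C (v 0) * C (v 0)⁻¹ : MvPolynomial (Fin 3) ℂ) = 1 := by
    rw [← C_mul, mul_inv_cancel₀ hv0, C_1]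
  have hgh : ∀ i, aeval h (g i) = X i := by
    intro i
    fin_cases i
    · simp [hg, hh]
      linear_combination X 0 * hC
    · simp [hg, hh]
      ring
    · simp [hg, hh]
      ring
  have hhg : ∀ i, aeval g (h i) = X i := by
    intro i
    fin_cases i
    · simp [hg, hh]
      linear_combination X 0 * hC
    · simp [hg, hh]
      linear_combination (-C (v 1) * X 0) * hC
    · simp [hg, hh]
      linear_combination (-C (v 2) * X 0) * hC
  let e : MvPolynomial (Fin 3) ℂ ≃ₐ[ℂ] MvPolynomial (Fin 3) ℂ :=
    AlgEquiv.ofAlgHom (aeval g) (aeval h)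
      (by ext1 i; rw [AlgHom.comp_apply, aeval_X, hhg, AlgHom.id_apply])
      (by ext1 i; rw [AlgHom.comp_apply, aeval_X, hgh, AlgHom.id_apply])
  have hesq : Squarefree (aeval g F) := squarefree_of_mulEquiv e.toMulEquiv hsq
  have heval : eval ![1, 0, 0] (aeval g F) = eval v F := by
    rw [eval_aeval]
    congr 2
    ext i
    fin_cases i <;> simp [hg]
  refine isSumOfTwoProducts_of_aeval hhhom hgh ?_
  have hGhom : (aeval g F).IsHomogeneous (2 * d) := by simpa using hF.aeval g hghom
  have hunit : IsUnit (C (eval v F)⁻¹ : MvPolynomial (Fin 3) ℂ) :=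
    (isUnit_iff_ne_zero.2 (inv_ne_zero hFv)).map C
  have := isSumOfTwoProducts_of_squarefree_of_eval_eq_one (hGhom.C_mul (eval v F)⁻¹)
    (hesq.squarefree_of_dvd (hunit.mul_left_dvd.2 dvd_rfl)) (by
      rw [map_mul, eval_C, heval, inv_mul_cancel₀ hFv])
  have := this.C_mul (eval v F)
  rwa [← mul_assoc, ← C_mul, mul_inv_cancel₀ hFv, C_1, one_mul] at this

theorem isSumOfTwoProducts_of_isHomogeneous (d : ℕ) : ∀ F : MvPolynomial (Fin 3) ℂ,
    F.IsHomogeneous (2 * d) → IsSumOfTwoProducts d F := by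
  induction d using Nat.strong_induction_on with
  | _ d ih =>
    intro F hF
    by_cases hF0 : F = 0
    · exact ⟨0, 0, 0, 0, isHomogeneous_zero _ _ _, isHomogeneous_zero _ _ _,
        isHomogeneous_zero _ _ _, isHomogeneous_zero _ _ _, by simp [hF0]⟩
    by_cases hsq : Squarefree F
    · exact isSumOfTwoProducts_of_squarefree hF hsq
    obtain ⟨g, ⟨H, hgH⟩, hg⟩ : ∃ g, g * g ∣ F ∧ ¬ IsUnit g := by
      simpa [Squarefree] using hsq
    have hH0 : H ≠ 0 := by
      rintro rfl
      exact hF0 (by rw [hgH, mul_zero])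
    have hg0 : g ≠ 0 := by
      rintro rfl
      exact hF0 (by rw [hgH, zero_mul, zero_mul])
    set e := g.totalDegree with he
    have hepos : e ≠ 0 := by
      intro h0
      rw [he, totalDegree_eq_zero_iff_eq_C] at h0
      apply hg
      rw [h0]
      refine (isUnit_iff_ne_zero.2 fun hc => hg0 ?_).map C
      rw [h0, hc, C_0]
    have hdeg : e + e + H.totalDegree = 2 * d := by
      rw [← hF.totalDegree hF0, hgH, totalDegree_mul_of_isDomain (mul_ne_zero hg0 hg0) hH0,
        totalDegree_mul_of_isDomain hg0 hg0]
    have hprod : F = homogeneousComponent e g * homogeneousComponent e g *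
        homogeneousComponent H.totalDegree H := by
      rw [← homogeneousComponent_mul_of_totalDegree_le le_rfl le_rfl,
        ← homogeneousComponent_mul_of_totalDegree_le (totalDegree_mul _ _) le_rfl, hdeg, ← hgH,
        homogeneousComponent_eq_self hF]
    have hge := homogeneousComponent_isHomogeneous e g
    obtain ⟨F₁, G₁, F₂, G₂, hF₁, hG₁, hF₂, hG₂, hsum⟩ := ih (d - e) (by omega)
      (homogeneousComponent H.totalDegree H) (by
        rw [show 2 * (d - e) = H.totalDegree by omega]
        exact homogeneousComponent_isHomogeneous _ _)
    have hmul : ∀ {A : MvPolynomial (Fin 3) ℂ}, A.IsHomogeneous (d - e) →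
        (homogeneousComponent e g * A).IsHomogeneous d := by
      intro A hA
      have := hge.mul hA
      rwa [show e + (d - e) = d by omega] at this
    refine ⟨_, _, _, _, hmul hF₁, hmul hG₁, hmul hF₂, hmul hG₂, ?_⟩
    rw [hprod, hsum]
    ring

theorem stmt_0 (d : ℕ) (hd : 1 ≤ d) (F : MvPolynomial (Fin 3) ℂ)
    (hF : F.IsHomogeneous (2 * d)) :
    ∃ F₁ G₁ F₂ G₂ : MvPolynomial (Fin 3) ℂ,
      F₁.IsHomogeneous d ∧ G₁.IsHomogeneous d ∧ F₂.IsHomogeneous d ∧ G₂.IsHomogeneous d ∧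
      F = F₁ * G₁ + F₂ * G₂ := by
  exact isSumOfTwoProducts_of_isHomogeneous d F hF
end

section
/- For every integer d > 0, there exist four homogeneous polynomials F₁, F₂, G₁, G₂ of degree d in ℂ[x,y,z] such that every homogeneous polynomial of degree 2d in ℂ[x,y,z] lies in the ideal (F₁, F₂, G₁, G₂) generated by them. -/
open MvPolynomial

/-- The product of the linear forms `u - k z` over `k ∈ s`. -/
noncomputable def pencilProd (u : MvPolynomial (Fin 3) ℂ) (s : Finset ℕ) :
    MvPolynomial (Fin 3) ℂ :=
  ∏ k ∈ s, (u - C (k : ℂ) * X 2)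

lemma isHomogeneous_pencilProd {u : MvPolynomial (Fin 3) ℂ} (hu : u.IsHomogeneous 1)
    (s : Finset ℕ) : (pencilProd u s).IsHomogeneous s.card := by
  have h := IsHomogeneous.prod s (fun k : ℕ ↦ u - C (k : ℂ) * X 2) (fun _ ↦ 1) fun k _ ↦
    hu.sub (by simpa using (isHomogeneous_C (Fin 3) (k : ℂ)).mul (isHomogeneous_X ℂ (2 : Fin 3)))
  simpa [pencilProd] using h

lemma eval_pencilProd_eq_zero_iff {u : MvPolynomial (Fin 3) ℂ} {v : Fin 3 → ℂ} {m : ℕ}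
    (hu : eval v u = m) (hv : v 2 = 1) (s : Finset ℕ) :
    eval v (pencilProd u s) = 0 ↔ m ∈ s := by
  simp [pencilProd, Finset.prod_eq_zero_iff, hu, hv, sub_eq_zero]

/-- The affine grid point `(a, b)`, seen in the chart `z = 1`. -/
def gridPoint (a b : ℕ) : Fin 3 → ℂ := ![a, b, 1]

lemma eval_gridPoint_pencilProd_X_zero (a b : ℕ) (s : Finset ℕ) :
    eval (gridPoint a b) (pencilProd (X 0) s) = 0 ↔ a ∈ s :=
  eval_pencilProd_eq_zero_iff (by simp [gridPoint]) (by simp [gridPoint]) s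

lemma eval_gridPoint_pencilProd_X_one (a b : ℕ) (s : Finset ℕ) :
    eval (gridPoint a b) (pencilProd (X 1) s) = 0 ↔ b ∈ s :=
  eval_pencilProd_eq_zero_iff (by simp [gridPoint]) (by simp [gridPoint]) s

lemma eval_gridPoint_pencilProd_add (a b : ℕ) (s : Finset ℕ) :
    eval (gridPoint a b) (pencilProd (X 0 + X 1) s) = 0 ↔ a + b ∈ s :=
  eval_pencilProd_eq_zero_iff (by simp [gridPoint]) (by simp [gridPoint]) s

lemma eval_gridPoint_X_two (a b : ℕ) : eval (gridPoint a b) (X 2) = 1 := by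
  simp [gridPoint]

/-- A form of degree `n` restricted to the line spanned by `v` is `F(v) tⁿ`. -/
lemma aeval_C_mul_X_of_isHomogeneous {σ R : Type*} [CommSemiring R]
    {F : MvPolynomial σ R} {n : ℕ} (hF : F.IsHomogeneous n) (v : σ → R) :
    aeval (fun i ↦ Polynomial.C (v i) * Polynomial.X) F =
      Polynomial.C (eval v F) * Polynomial.X ^ n := by
  rw [aeval_def, eval₂_eq, eval_eq, map_sum, Finset.sum_mul]
  refine Finset.sum_congr rfl fun m hm ↦ ?_
  have hdeg : ∑ i ∈ m.support, m i = n := by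
    simpa [Finsupp.weight_apply, Finsupp.sum] using hF (mem_support_iff.mp hm)
  simp [mul_pow, Finset.prod_mul_distrib, Finset.prod_pow_eq_pow_sum, hdeg, mul_assoc,
    Polynomial.algebraMap_eq]

/-- A form vanishing on the `d × d` grid lies in the ideal of the two pencils cutting it out. -/
lemma mem_span_of_eval_gridPoint_eq_zero {d n : ℕ} (hd : 0 < d)
    {Q : MvPolynomial (Fin 3) ℂ} (hQ : Q.IsHomogeneous n)
    (hzero : ∀ a < d, ∀ b < d, eval (gridPoint a b) Q = 0) :
    Q ∈ Ideal.span {pencilProd (X 0) (Finset.range d), pencilProd (X 1) (Finset.range d)} := by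
  classical
  let φ : MvPolynomial (Fin 3) ℂ →ₐ[ℂ] MvPolynomial (Fin 2) (Polynomial ℂ) :=
    aeval ![X 0, X 1, C Polynomial.X]
  let ψ : MvPolynomial (Fin 2) (Polynomial ℂ) →+* MvPolynomial (Fin 3) ℂ :=
    eval₂Hom (Polynomial.aeval (X 2 : MvPolynomial (Fin 3) ℂ)).toRingHom ![X 0, X 1]
  have hψφ : ∀ P, ψ (φ P) = P := by
    intro P
    have : ψ.comp φ.toRingHom = RingHom.id _ := by
      apply MvPolynomial.ringHom_ext
      · intro r
        simp [φ, ψ, MvPolynomial.algebraMap_apply]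
      · intro i
        fin_cases i <;> simp [φ, ψ]
    exact RingHom.congr_fun this P
  let root : ℕ → Polynomial ℂ := fun k ↦ Polynomial.C (k : ℂ) * Polynomial.X
  have hroot : Function.Injective root := fun k l h ↦ by
    simpa [root] using congrArg (Polynomial.eval 1) h
  obtain ⟨h, -, hh⟩ := combinatorial_nullstellensatz_exists_linearCombination
    (fun _ : Fin 2 ↦ (Finset.range d).image root)
    (fun _ ↦ (Finset.nonempty_range_iff.mpr hd.ne').image root) (φ Q) (by
      intro x hx
      obtain ⟨a, ha, hxa⟩ := Finset.mem_image.mp (hx 0)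
      obtain ⟨b, hb, hxb⟩ := Finset.mem_image.mp (hx 1)
      have hcomp : eval x (φ Q) =
          aeval (fun i ↦ Polynomial.C (gridPoint a b i) * Polynomial.X) Q := by
        have : (eval x).comp φ.toRingHom =
            (aeval (R := ℂ) fun i ↦ Polynomial.C (gridPoint a b i) * Polynomial.X).toRingHom := by
          apply MvPolynomial.ringHom_ext
          · intro r
            simp [φ, MvPolynomial.algebraMap_apply]
          · intro i
            fin_cases i <;> simp [φ, gridPoint, ← hxa, ← hxb, root]
        exact RingHom.congr_fun this Q
      rw [hcomp, aeval_C_mul_X_of_isHomogeneous hQ, hzero a (Finset.mem_range.mp ha) b (Finset.mem_range.mp hb)]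
      simp)
  have hprod : ∀ i : Fin 2, ψ (∏ r ∈ (Finset.range d).image root, (X i - C r)) =
      pencilProd (![X 0, X 1] i) (Finset.range d) := by
    intro i
    rw [Finset.prod_image hroot.injOn, map_prod]
    simp [ψ, root, pencilProd, ← MvPolynomial.algebraMap_eq]
  have hQeq := congrArg ψ hh
  rw [hψφ, Finsupp.linearCombination_apply, Finsupp.sum_fintype _ _ (by simp)] at hQeq
  simp only [Fin.sum_univ_two, smul_eq_mul, map_add, map_mul, hprod] at hQeq
  rw [Ideal.mem_span_pair]
  exact ⟨ψ (h 0), ψ (h 1), by simpa using hQeq.symm⟩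

/-- The diagonals `x + y = k z` with `k < d` and with `d ≤ k < 2 d` separate the `d × d` grid into
two triangles; multiples of the two products interpolate at any single grid point. -/
lemma exists_form_supported_at_gridPoint {d a b : ℕ} (ha : a < d) (hb : b < d) :
    ∃ H : MvPolynomial (Fin 3) ℂ, H.IsHomogeneous (2 * d) ∧
      H ∈ Ideal.span {pencilProd (X 0 + X 1) (Finset.Ico d (2 * d)),
        pencilProd (X 0 + X 1) (Finset.range d)} ∧
      eval (gridPoint a b) H ≠ 0 ∧
      ∀ a' < d, ∀ b' < d, (a', b') ≠ (a, b) → eval (gridPoint a' b') H = 0 := by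
  have hx := isHomogeneous_pencilProd (isHomogeneous_X ℂ (0 : Fin 3))
  have hy := isHomogeneous_pencilProd (isHomogeneous_X ℂ (1 : Fin 3))
  have hxy := isHomogeneous_pencilProd
    ((isHomogeneous_X ℂ (0 : Fin 3)).add (isHomogeneous_X ℂ (1 : Fin 3)))
  have hz := isHomogeneous_X ℂ (2 : Fin 3)
  rcases lt_or_ge (a + b) d with hab | hab
  · refine ⟨pencilProd (X 0 + X 1) (Finset.Ico d (2 * d)) * (pencilProd (X 0) (Finset.range a) *
      pencilProd (X 1) (Finset.range b) * pencilProd (X 0 + X 1) (Finset.Ico (a + b + 1) d) *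
      X 2), ?_, Ideal.mul_mem_right _ _ (Ideal.subset_span (by simp)), ?_, ?_⟩
    · convert! (hxy _).mul ((((hx _).mul (hy _)).mul (hxy _)).mul hz) using 1
      simp only [Finset.card_range, Nat.card_Ico]
      omega
    · simp only [map_mul, ne_eq, mul_eq_zero, eval_gridPoint_pencilProd_X_zero,
        eval_gridPoint_pencilProd_X_one, eval_gridPoint_pencilProd_add, eval_gridPoint_X_two,
        one_ne_zero, or_false, Finset.mem_range, Finset.mem_Ico]
      omega
    · intro a' ha' b' hb' hne
      simp only [map_mul, mul_eq_zero, eval_gridPoint_pencilProd_X_zero,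
        eval_gridPoint_pencilProd_X_one, eval_gridPoint_pencilProd_add, eval_gridPoint_X_two,
        one_ne_zero, or_false, Finset.mem_range, Finset.mem_Ico]
      simp only [ne_eq, Prod.mk.injEq] at hne
      omega
  · refine ⟨pencilProd (X 0 + X 1) (Finset.range d) * (pencilProd (X 0) (Finset.Ico (a + 1) d) *
      pencilProd (X 1) (Finset.Ico (b + 1) d) * pencilProd (X 0 + X 1) (Finset.Ico d (a + b)) *
      X 2 ^ 2), ?_, Ideal.mul_mem_right _ _ (Ideal.subset_span (by simp)), ?_, ?_⟩
    · convert! (hxy _).mul ((((hx _).mul (hy _)).mul (hxy _)).mul (hz.pow 2)) using 1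
      simp only [Finset.card_range, Nat.card_Ico]
      omega
    · simp only [map_mul, map_pow, ne_eq, mul_eq_zero, eval_gridPoint_pencilProd_X_zero,
        eval_gridPoint_pencilProd_X_one, eval_gridPoint_pencilProd_add, eval_gridPoint_X_two,
        one_pow, one_ne_zero, or_false, Finset.mem_range, Finset.mem_Ico]
      omega
    · intro a' ha' b' hb' hne
      simp only [map_mul, map_pow, mul_eq_zero, eval_gridPoint_pencilProd_X_zero,
        eval_gridPoint_pencilProd_X_one, eval_gridPoint_pencilProd_add, eval_gridPoint_X_two,
        one_pow, one_ne_zero, or_false, Finset.mem_range, Finset.mem_Ico]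
      simp only [ne_eq, Prod.mk.injEq] at hne
      omega

theorem stmt_1 (d : ℕ) (hd : 0 < d) :
    ∃ F₁ F₂ G₁ G₂ : MvPolynomial (Fin 3) ℂ,
      F₁.IsHomogeneous d ∧ F₂.IsHomogeneous d ∧ G₁.IsHomogeneous d ∧ G₂.IsHomogeneous d ∧
      ∀ F : MvPolynomial (Fin 3) ℂ, F.IsHomogeneous (2 * d) →
        F ∈ Ideal.span ({F₁, F₂, G₁, G₂} : Set (MvPolynomial (Fin 3) ℂ)) := by
  have hxy := isHomogeneous_pencilProd
    ((isHomogeneous_X ℂ (0 : Fin 3)).add (isHomogeneous_X ℂ (1 : Fin 3)))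
  refine ⟨pencilProd (X 0) (Finset.range d), pencilProd (X 1) (Finset.range d),
    pencilProd (X 0 + X 1) (Finset.Ico d (2 * d)), pencilProd (X 0 + X 1) (Finset.range d),
    by simpa using isHomogeneous_pencilProd (isHomogeneous_X ℂ (0 : Fin 3)) (Finset.range d),
    by simpa using isHomogeneous_pencilProd (isHomogeneous_X ℂ (1 : Fin 3)) (Finset.range d),
    by simpa [two_mul] using hxy (Finset.Ico d (2 * d)),
    by simpa using hxy (Finset.range d), fun F hF ↦ ?_⟩
  choose H hH hmem hne hvanish using fun p : Fin d × Fin d ↦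
    exists_form_supported_at_gridPoint p.1.isLt p.2.isLt
  let c : Fin d × Fin d → ℂ := fun p ↦
    eval (gridPoint p.1 p.2) F / eval (gridPoint p.1 p.2) (H p)
  let E := ∑ p, C (c p) * H p
  have hE : E.IsHomogeneous (2 * d) := IsHomogeneous.sum _ _ _ fun p _ ↦ by
    simpa using (isHomogeneous_C (Fin 3) (c p)).mul (hH p)
  have hrest := mem_span_of_eval_gridPoint_eq_zero hd (hF.sub hE) fun a ha b hb ↦ by
    have hsum : eval (gridPoint a b) E = eval (gridPoint a b) F := by
      simp only [E, map_sum, map_mul, eval_C]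
      rw [Finset.sum_eq_single (⟨a, ha⟩, ⟨b, hb⟩)]
      · exact div_mul_cancel₀ _ (hne (⟨a, ha⟩, ⟨b, hb⟩))
      · intro p _ hp
        rw [hvanish p a ha b hb fun h ↦ hp ?_, mul_zero]
        simp only [Prod.mk.injEq] at h
        exact Prod.ext (Fin.ext h.1.symm) (Fin.ext h.2.symm)
      · simp
    rw [map_sub, hsum, sub_self]
  rw [← sub_add_cancel F E]
  refine add_mem (Ideal.span_mono (by grind) hrest) (sum_mem fun p _ ↦ ?_)
  exact Ideal.mul_mem_left _ _ (Ideal.span_mono (by grind) (hmem p))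
end

section
/- For every integer d > 0, there exist homogeneous polynomials F₁, F₂, G₂, G₁ of degree d in ℂ[x,y,z] such that for every homogeneous polynomial Q of degree 2d in ℂ[x,y,z] there exists a homogeneous polynomial P of degree d with Q − P·G₁ belonging to the ideal (F₁, F₂, G₂); equivalently, the multiplication-by-G₁ map from the degree-d component to the degree-2d component of ℂ[x,y,z]/(F₁,F₂,G₂) is surjective. -/
open MvPolynomial

section ContinuantSeq

variable {R : Type*} [CommRing R]

/-- Homogenized Chebyshev-type polynomials, given by
`p 0 = 1`, `p 1 = x`, `p (n + 2) = x * p (n + 1) - z ^ 2 * p n`. -/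
def continuantSeq (x z : R) : ℕ → R
  | 0 => 1
  | 1 => x
  | n + 2 => x * continuantSeq x z (n + 1) - z ^ 2 * continuantSeq x z n

theorem continuantSeq_add_two (x z : R) (n : ℕ) :
    continuantSeq x z (n + 2) =
      x * continuantSeq x z (n + 1) - z ^ 2 * continuantSeq x z n := rfl

theorem continuantSeq_isHomogeneous {σ : Type*} {x z : MvPolynomial σ R}
    (hx : x.IsHomogeneous 1) (hz : z.IsHomogeneous 1) (n : ℕ) :
    (continuantSeq x z n).IsHomogeneous n := by
  induction n using Nat.twoStepInduction with
  | zero => exact isHomogeneous_one σ R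
  | one => exact hx
  | more n ih₀ ih₁ =>
    rw [continuantSeq_add_two]
    refine IsHomogeneous.sub ?_ ?_
    · convert hx.mul ih₁ using 1
      omega
    · convert (hz.pow 2).mul ih₀ using 1
      omega

variable {I : Ideal R} {x y z : R} {e : ℕ}

theorem continuantSeq_mem_of_le (h₁ : continuantSeq x z (e + 1) ∈ I)
    (h₂ : z * continuantSeq x z e ∈ I) {n : ℕ} (hn : e + 1 ≤ n) :
    continuantSeq x z n ∈ I := by
  have key : ∀ m, continuantSeq x z (e + 1 + m) ∈ I ∧ z * continuantSeq x z (e + m) ∈ I := by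
    intro m
    induction m with
    | zero => exact ⟨h₁, h₂⟩
    | succ m ih =>
      have h := I.sub_mem (I.mul_mem_left x ih.1) (I.mul_mem_left z ih.2)
      refine ⟨?_, ?_⟩
      · convert h using 1
        rw [show e + 1 + (m + 1) = e + m + 2 by ring, continuantSeq_add_two,
          show e + 1 + m = e + m + 1 by ring]
        ring
      · rw [show e + (m + 1) = e + 1 + m by ring]
        exact I.mul_mem_left z ih.1
  obtain ⟨m, rfl⟩ := Nat.exists_eq_add_of_le hn
  exact (key m).1

theorem pow_mul_continuantSeq_mem (h₁ : continuantSeq x z (e + 1) ∈ I)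
    (h₂ : z * continuantSeq x z e ∈ I) (m i : ℕ) (hmi : i + m = e) :
    z ^ (2 * m + 1) * continuantSeq x z i ∈ I ∧
      z ^ (2 * m + 1) * continuantSeq x z (i + 1) ∈ I := by
  induction m generalizing i with
  | zero =>
    obtain rfl : i = e := by omega
    exact ⟨by simpa using h₂, I.mul_mem_left _ h₁⟩
  | succ m ih =>
    obtain ⟨ha, hb⟩ := ih (i + 1) (by omega)
    refine ⟨?_, ?_⟩
    · convert I.sub_mem (I.mul_mem_left x ha) hb using 1
      rw [continuantSeq_add_two]
      ring
    · convert I.mul_mem_left (z ^ 2) ha using 1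
      ring

/-- Any `p i * z ^ k` lies in `(p (e + 1), z * p e)` as soon as `2 * i + k > 2 * e`. -/
theorem continuantSeq_mul_pow_mem (h₁ : continuantSeq x z (e + 1) ∈ I)
    (h₂ : z * continuantSeq x z e ∈ I) {i k : ℕ} (hik : 2 * e < 2 * i + k) :
    continuantSeq x z i * z ^ k ∈ I := by
  rcases Nat.lt_or_ge e i with hi | hi
  · exact I.mul_mem_right _ (continuantSeq_mem_of_le h₁ h₂ hi)
  · obtain ⟨m, rfl⟩ := Nat.exists_eq_add_of_le hi
    obtain ⟨l, rfl⟩ := Nat.exists_eq_add_of_le (show 2 * m + 1 ≤ k by omega)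
    convert I.mul_mem_left (z ^ l) (pow_mul_continuantSeq_mem h₁ h₂ m i rfl).1 using 1
    ring

theorem pow_succ_mul_continuantSeq_mem {a n : ℕ} {t : R}
    (h : ∀ i k, i + k = n + 1 → x ^ a * continuantSeq x z i * (t * z ^ k) ∈ I) (i k : ℕ)
    (hik : i + k = n) : x ^ (a + 1) * continuantSeq x z i * (t * z ^ k) ∈ I := by
  cases i with
  | zero =>
    convert h 1 k (by omega) using 1
    simp only [continuantSeq]
    ring
  | succ i =>
    convert I.add_mem (h (i + 2) k (by omega)) (h i (k + 2) (by omega)) using 1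
    rw [continuantSeq_add_two]
    ring

/-- Membership of `x ^ a * p i * z ^ k * t` in `I` follows from that of all `p i * z ^ k * t` of the
same total degree. -/
theorem pow_mul_continuantSeq_mem_of_forall {a n : ℕ} {t : R}
    (h : ∀ i k, i + k = n + a → continuantSeq x z i * (t * z ^ k) ∈ I) (i k : ℕ)
    (hik : i + k = n) : x ^ a * continuantSeq x z i * (t * z ^ k) ∈ I := by
  induction a generalizing n i k with
  | zero => simpa using h i k hik
  | succ a ih =>
    refine pow_succ_mul_continuantSeq_mem (n := n) (fun i k hik => ?_) i k hik
    exact ih (n := n + 1) (fun i k hik => h i k (by omega)) i k hik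

theorem pow_mul_pow_mul_pow_mem
    (hx₁ : continuantSeq x z (e + 1) ∈ I) (hx₂ : z * continuantSeq x z e ∈ I)
    (hy₁ : continuantSeq y z (e + 1) ∈ I) (hy₂ : z * continuantSeq y z e ∈ I)
    {a b c : ℕ} (habc : a + b + c = 2 * (e + 1)) : x ^ a * y ^ b * z ^ c ∈ I := by
  have h := pow_mul_continuantSeq_mem_of_forall (I := I) (x := x) (z := z) (a := a) (n := c)
    (t := y ^ b) (fun i k hik => ?_) 0 c (by omega)
  · simpa [continuantSeq, mul_assoc] using h
  have h := pow_mul_continuantSeq_mem_of_forall (I := I) (x := y) (z := z) (a := b) (n := k)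
    (t := continuantSeq x z i) (fun j l hjl => ?_) 0 k (by omega)
  · convert h using 1
    simp only [continuantSeq]
    ring
  rcases le_total i j with hij | hij
  · convert I.mul_mem_left (continuantSeq x z i)
      (continuantSeq_mul_pow_mem (i := j) (k := l) hy₁ hy₂ (by omega)) using 1
    ring
  · convert I.mul_mem_left (continuantSeq y z j)
      (continuantSeq_mul_pow_mem (i := i) (k := l) hx₁ hx₂ (by omega)) using 1

end ContinuantSeq

theorem MvPolynomial.homogeneousComponent_add_mul {σ R : Type*} [CommSemiring R]
    {F : MvPolynomial σ R} {n : ℕ} (hF : F.IsHomogeneous n) (m : ℕ) (a : MvPolynomial σ R) :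
    homogeneousComponent (m + n) (a * F) = homogeneousComponent m a * F := by
  conv_lhs => rw [← sum_homogeneousComponent a, Finset.sum_mul, map_sum]
  have h : ∀ i, homogeneousComponent (m + n) (homogeneousComponent i a * F) =
      if i = m then homogeneousComponent m a * F else 0 := by
    intro i
    rw [homogeneousComponent_of_mem ((homogeneousComponent_isHomogeneous i a).mul hF)]
    by_cases him : i = m
    · simp [him]
    · rw [if_neg him, if_neg (by omega)]
  simp only [h, Finset.sum_ite_eq', Finset.mem_range]
  split_ifs with hm
  · rfl
  · rw [homogeneousComponent_eq_zero _ _ (by omega), zero_mul]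

theorem stmt_2 (d : ℕ) (hd : 0 < d) :
    ∃ F₁ F₂ G₂ G₁ : MvPolynomial (Fin 3) ℂ,
      F₁.IsHomogeneous d ∧ F₂.IsHomogeneous d ∧ G₂.IsHomogeneous d ∧ G₁.IsHomogeneous d ∧
      ∀ Q : MvPolynomial (Fin 3) ℂ, Q.IsHomogeneous (2 * d) →
        ∃ P : MvPolynomial (Fin 3) ℂ, P.IsHomogeneous d ∧
          Q - P * G₁ ∈ Ideal.span ({F₁, F₂, G₂} : Set (MvPolynomial (Fin 3) ℂ)) := by
  obtain ⟨e, rfl⟩ := Nat.exists_eq_succ_of_ne_zero hd.ne'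
  rw [Nat.succ_eq_add_one]
  have hX (i : Fin 3) : (X i : MvPolynomial (Fin 3) ℂ).IsHomogeneous 1 := isHomogeneous_X ℂ i
  have hp (i : Fin 3) := continuantSeq_isHomogeneous (hX i) (hX 2)
  have hzp (i : Fin 3) :
      (X 2 * continuantSeq (X i) (X 2) e : MvPolynomial (Fin 3) ℂ).IsHomogeneous (e + 1) := by
    convert (hX 2).mul (hp i e) using 1
    omega
  refine ⟨continuantSeq (X 0) (X 2) (e + 1), X 2 * continuantSeq (X 0) (X 2) e,
    continuantSeq (X 1) (X 2) (e + 1), X 2 * continuantSeq (X 1) (X 2) e,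
    hp 0 _, hzp 0, hp 1 _, hzp 1, fun Q hQ => ?_⟩
  set F₁ : MvPolynomial (Fin 3) ℂ := continuantSeq (X 0) (X 2) (e + 1) with hF₁
  set F₂ : MvPolynomial (Fin 3) ℂ := X 2 * continuantSeq (X 0) (X 2) e with hF₂
  set G₂ : MvPolynomial (Fin 3) ℂ := continuantSeq (X 1) (X 2) (e + 1) with hG₂
  set G₁ : MvPolynomial (Fin 3) ℂ := X 2 * continuantSeq (X 1) (X 2) e with hG₁
  have hmem : Q ∈ Ideal.span ({G₁, F₁, F₂, G₂} : Set (MvPolynomial (Fin 3) ℂ)) := by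
    rw [Q.as_sum]
    refine Ideal.sum_mem _ fun s hs => ?_
    have hdeg : s.degree = 2 * (e + 1) := by
      rw [Finsupp.degree_eq_weight_one]
      exact hQ (mem_support_iff.mp hs)
    rw [Finsupp.degree_eq_sum, Fin.sum_univ_three] at hdeg
    rw [monomial_eq, Finsupp.prod_fintype _ _ (by simp), Fin.prod_univ_three]
    refine Ideal.mul_mem_left _ _ (pow_mul_pow_mul_pow_mem (e := e) ?_ ?_ ?_ ?_ hdeg) <;>
      exact Ideal.subset_span (by simp [hF₁, hF₂, hG₁, hG₂])
  obtain ⟨c, r, hr, hQcr⟩ := Ideal.mem_span_insert.mp hmem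
  obtain ⟨a₁, a₂, a₃, rfl⟩ := Submodule.mem_span_triple.mp hr
  refine ⟨homogeneousComponent (e + 1) c, homogeneousComponent_isHomogeneous _ _, ?_⟩
  have hcomp := congrArg (homogeneousComponent (e + 1 + (e + 1))) hQcr
  rw [two_mul] at hQ
  simp only [smul_eq_mul, map_add, homogeneousComponent_of_mem hQ, if_true,
    homogeneousComponent_add_mul (hzp 1), homogeneousComponent_add_mul (hp 0 (e + 1)),
    homogeneousComponent_add_mul (hzp 0), homogeneousComponent_add_mul (hp 1 (e + 1)),
    F₁, F₂, G₁, G₂] at hcomp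
  rw [hcomp, add_sub_cancel_left]
  exact Submodule.mem_span_triple.mpr ⟨_, _, _, rfl⟩
end

section
/- Let F ∈ ℂ[x,y,z] be a homogeneous polynomial of degree 2d (d ≥ 1) defining a smooth plane curve, i.e., the only common zero in ℂ³ of the three partial derivatives ∂F/∂x, ∂F/∂y, ∂F/∂z is the origin. Suppose F = F₁G₁ + F₂G₂ with F₁, G₁, F₂, G₂ homogeneous of degree d, and let P ∈ ℂ³ be a nonzero common zero of F₁ and F₂. Then it is not the case that both gradients vanish at P; that is, at least one of F₁, F₂ has a nonvanishing gradient at P. -/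
open MvPolynomial

theorem stmt_3 (d : ℕ) (hd : 1 ≤ d) (F F₁ G₁ F₂ G₂ : MvPolynomial (Fin 3) ℂ)
    (hF : F.IsHomogeneous (2 * d))
    (hsmooth : ∀ P : Fin 3 → ℂ, (∀ i, eval P (pderiv i F) = 0) → P = 0)
    (hF₁ : F₁.IsHomogeneous d) (hG₁ : G₁.IsHomogeneous d)
    (hF₂ : F₂.IsHomogeneous d) (hG₂ : G₂.IsHomogeneous d)
    (heq : F = F₁ * G₁ + F₂ * G₂)
    (P : Fin 3 → ℂ) (hP : P ≠ 0) (hPF₁ : eval P F₁ = 0) (hPF₂ : eval P F₂ = 0) :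
    ¬ ((∀ i, eval P (pderiv i F₁) = 0) ∧ (∀ i, eval P (pderiv i F₂) = 0)) := by
  rintro ⟨h₁, h₂⟩
  refine hP (hsmooth P fun i => ?_)
  simp [heq, Derivation.leibniz, hPF₁, hPF₂, h₁ i, h₂ i]
end
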